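/- For every r ≥ 1 and every v ∈ O_m, the number of zero-sum 2r-element subsets of O_m containing v satisfies 2^{m−1}·#{S ⊆ O_m : |S| = 2r, ∑S = 0, v ∈ S} = 2r·a_{2r}(O_m). -/

import Mathlib

open Finset Polynomial

/-- The ambient 𝔽₂-vector space `V = (ZMod 2)^m`. -/
abbrev V (m : ℕ) := Fin m → ZMod 2

/-- `Hm m` is the set of the `2^m - 1` nonzero vectors of `V m`. -/
def Hm (m : ℕ) : Finset (V m) := Finset.univ.filter (fun v => v ≠ 0)

/-- `Om m` is the set of odd-weight vectors of `V m`. -/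
def Om (m : ℕ) : Finset (V m) := Finset.univ.filter (fun v => (∑ i, v i) = 1)

/-- `Em m` is the set of nonzero even-weight vectors of `V m`. -/
def Em (m : ℕ) : Finset (V m) := Finset.univ.filter (fun v => v ≠ 0 ∧ (∑ i, v i) = 0)

/-- The number of `i`-element subsets of `d` whose elements sum to `ψ`. -/
def sumCount (m : ℕ) (d : Finset (V m)) (i : ℕ) (ψ : V m) : ℕ :=
  ((d.powersetCard i).filter (fun S => S.sum id = ψ)).card

/-- `wordCount m d i = a_i(d)`, the number of `i`-element subsets of `d` summing to `0`. -/
def wordCount (m : ℕ) (d : Finset (V m)) (i : ℕ) : ℕ := sumCount m d i 0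

/-- The rank of a finite set of vectors: the dimension of its span over `𝔽₂`. -/
noncomputable def rankOf (m : ℕ) (f : Finset (V m)) : ℕ :=
  Module.finrank (ZMod 2) (Submodule.span (ZMod 2) (f : Set (V m)))

/-- `d₁` has smaller aberration than `d₂`. -/
def SmallerAberration (m : ℕ) (d₁ d₂ : Finset (V m)) : Prop :=
  ∃ s, 1 ≤ s ∧ wordCount m d₁ s < wordCount m d₂ s ∧
    ∀ t < s, wordCount m d₁ t = wordCount m d₂ t

/-- `d` is a minimum aberration design. -/
def IsMA (m : ℕ) (d : Finset (V m)) : Prop :=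
  d ⊆ Hm m ∧ ∀ d' ⊆ Hm m, d'.card = d.card → ¬ SmallerAberration m d' d

/-- The word-length pattern polynomial `P_f(X) = ∑ a_i(f) X^i` of a design `f`. -/
noncomputable def WLPP (m : ℕ) (f : Finset (V m)) : Polynomial ℤ :=
  ∑ i ∈ Finset.range (f.card + 1), (wordCount m f i : ℤ) • X ^ i

/-- `Q_ψ(X) = ∑ q_i(ψ) X^i`, where `q_i(ψ)` counts `i`-element subsets of `O_m` summing to `ψ`. -/
noncomputable def Qpoly (m : ℕ) (ψ : V m) : Polynomial ℤ :=
  ∑ i ∈ Finset.range ((Om m).card + 1), (sumCount m (Om m) i ψ : ℤ) • X ^ i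

theorem two_mul_card_Om (m : ℕ) (v : V m) (hv : v ∈ Om m) : 2 * (Om m).card = 2 ^ m := by
  have hv1 : ∑ i, v i = 1 := by simpa [Om] using hv
  have hcompl : (univ.filter fun w : V m => ¬ (∑ i, w i) = 1).card = (Om m).card := by
    refine card_bij' (fun w _ => w + v) (fun w _ => w + v) ?_ ?_ ?_ ?_
    · intro w hw
      simp only [mem_filter, mem_univ, true_and, Om, Pi.add_apply, sum_add_distrib, hv1] at hw ⊢
      generalize (∑ i, w i) = x at hw ⊢
      revert x
      decide
    · intro w hw
      simp only [mem_filter, mem_univ, true_and, Om, Pi.add_apply, sum_add_distrib, hv1] at hw ⊢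
      rw [hw]
      decide
    all_goals
      intro w _
      exact funext fun i => by simp [add_assoc, CharTwo.add_self_eq_zero]
  have htotal := card_filter_add_card_filter_not (s := (univ : Finset (V m)))
    (fun w => (∑ i, w i) = 1)
  rw [hcompl] at htotal
  simp only [card_univ, Fintype.card_fun, ZMod.card, Fintype.card_fin] at htotal
  rw [two_mul]
  exact htotal

theorem card_Om (m : ℕ) (hm : 1 ≤ m) (v : V m) (hv : v ∈ Om m) :
    (Om m).card = 2 ^ (m - 1) := by
  obtain ⟨n, rfl⟩ := Nat.exists_eq_add_of_le' hm
  have h := two_mul_card_Om (n + 1) v hv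
  rw [pow_succ] at h
  simp only [Nat.add_sub_cancel]
  omega

/-- Translation by the even-weight vector `v + w` carries the zero-sum `2r`-subsets of `O_m`
through `v` to those through `w`. -/
theorem card_zero_sum_through_le (m r : ℕ) (v w : V m) (hv : v ∈ Om m) (hw : w ∈ Om m) :
    (((Om m).powersetCard (2 * r)).filter (fun S => S.sum id = 0 ∧ v ∈ S)).card ≤
      (((Om m).powersetCard (2 * r)).filter (fun S => S.sum id = 0 ∧ w ∈ S)).card := by
  refine card_le_card_of_injOn (fun S => S.map (addRightEmbedding (v + w))) ?_
    (map_injective _).injOn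
  intro S hS
  simp only [coe_filter, Set.mem_ofPred_eq, mem_powersetCard] at hS ⊢
  obtain ⟨⟨hsub, hcard⟩, hsum, hvS⟩ := hS
  refine ⟨⟨?_, by rw [card_map, hcard]⟩, ?_, ?_⟩
  · intro x hx
    obtain ⟨y, hy, rfl⟩ := mem_map.1 hx
    have hyO := hsub hy
    simp only [Om, mem_filter, mem_univ, true_and] at hv hw hyO
    simp only [Om, mem_filter, mem_univ, true_and, addRightEmbedding_apply, Pi.add_apply,
      sum_add_distrib, hv, hw, hyO]
    decide
  · simp only [id_eq] at hsum
    simp only [sum_map, id_eq, addRightEmbedding_apply, sum_add_distrib, hsum, sum_const, hcard,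
      mul_smul, zero_add]
    exact funext fun i => by simp [CharTwo.two_eq_zero]
  · refine mem_map.2 ⟨v, hvS, funext fun i => ?_⟩
    simp [← add_assoc, CharTwo.add_self_eq_zero]

/-- For `r ≥ 1` and `v ∈ O_m`, the zero-sum `2r`-element subsets of
`O_m` containing `v` satisfy `2^{m-1} · #{S : ∑S = 0, v ∈ S} = 2r · a_{2r}(O_m)`. -/
theorem zero_sum_subsets_through_a_point (m : ℕ) (hm : 2 ≤ m)
    (r : ℕ) (hr : 1 ≤ r) (v : V m) (hv : v ∈ Om m) :
    2 ^ (m - 1) *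
        (((Om m).powersetCard (2 * r)).filter (fun S => S.sum id = 0 ∧ v ∈ S)).card =
      2 * r * wordCount m (Om m) (2 * r) := by
  have hcount : ∀ w ∈ Om m,
      (((Om m).powersetCard (2 * r)).filter (fun S => S.sum id = 0 ∧ w ∈ S)).card =
        (((Om m).powersetCard (2 * r)).filter (fun S => S.sum id = 0 ∧ v ∈ S)).card := fun w hw =>
    le_antisymm (card_zero_sum_through_le m r w v hw hv) (card_zero_sum_through_le m r v w hv hw)
  have hdouble := sum_card_bipartiteAbove_eq_sum_card_bipartiteBelow (s := Om m)
    (t := ((Om m).powersetCard (2 * r)).filter fun S => S.sum id = 0) (fun w S => w ∈ S)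
  simp only [bipartiteAbove, bipartiteBelow, filter_filter] at hdouble
  rw [sum_congr rfl hcount, sum_const, smul_eq_mul, card_Om m (by omega) v hv] at hdouble
  rw [hdouble, wordCount, sumCount, mul_comm (2 * r)]
  refine sum_const_nat fun S hS => ?_
  obtain ⟨hsub, hcard⟩ := mem_powersetCard.1 (mem_filter.1 hS).1
  rw [filter_mem_eq_inter, inter_eq_right.2 hsub, hcard]
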